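/- Let n ≥ 1, let L be a ℂ-linear subspace of ℂⁿ (i.e. of Fin n → ℂ), and let a ∈ ℂⁿ be a nonzero vector such that ∑_i a_i b_i = 0 for every b ∈ L. Then a does not belong to the closure, in ℂⁿ with the product topology, of the set { (fun i => (b i)⁻¹) | b ∈ L, ∀ i, b i ≠ 0 } of coordinatewise inverses of the entrywise-nonvanishing elements of L. -/

import Mathlib

/-- If `a ∈ ℂⁿ` is nonzero and orthogonal (for the bilinear pairing `∑ i, a i * b i`)
to a linear subspace `L ⊆ ℂⁿ`, then `a` is not in the closure of the set of
coordinatewise inverses of the entrywise-nonvanishing elements of `L`. -/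
theorem diag_perp_disjoint_closure_of_inverses
    (n : ℕ) (hn : 1 ≤ n) (L : Submodule ℂ (Fin n → ℂ)) (a : Fin n → ℂ)
    (ha : a ≠ 0) (horth : ∀ b ∈ L, ∑ i, a i * b i = 0) :
    a ∉ closure {y : Fin n → ℂ |
      ∃ b ∈ L, (∀ i, b i ≠ 0) ∧ y = fun i => (b i)⁻¹} := by
  intro hmem
  have hcont : ContinuousAt (fun y : Fin n → ℂ => ∑ i, a i * (y i)⁻¹) a := by
    refine tendsto_finsetSum _ fun i _ => ?_
    by_cases h : a i = 0
    · simp only [h, zero_mul]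
      exact tendsto_const_nhds
    · exact ((continuous_apply i).continuousAt.inv₀ h).tendsto.const_mul (a i)
  have hzero : ∑ i, a i * (a i)⁻¹ = 0 := by
    have h1 := hcont.continuousWithinAt.mem_closure_image hmem
    have h2 : (fun y : Fin n → ℂ => ∑ i, a i * (y i)⁻¹) '' {y : Fin n → ℂ |
        ∃ b ∈ L, (∀ i, b i ≠ 0) ∧ y = fun i => (b i)⁻¹} ⊆ {0} := by
      rintro _ ⟨_, ⟨b, hb, -, rfl⟩, rfl⟩
      simpa using horth b hb
    simpa using closure_mono h2 h1
  have hsum : ∑ i, a i * (a i)⁻¹ = ∑ i, if a i ≠ 0 then (1 : ℂ) else 0 := by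
    refine Finset.sum_congr rfl fun i _ => ?_
    by_cases h : a i = 0 <;> simp [h]
  rw [hsum, Finset.sum_boole, Nat.cast_eq_zero, Finset.card_eq_zero] at hzero
  apply ha
  funext i
  by_contra h
  have hi : i ∈ Finset.filter (fun i => a i ≠ 0) Finset.univ := by simpa using h
  rw [hzero] at hi
  simp at hi
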